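/- arXiv:math/0612784 — 6 statements merged into one kernel-verified Lean document; each statement's English description precedes it below -/
import Mathlib

section
/- Let λ > 0, v > 0, t > 0 and let p ≥ 1 be a natural number. Then (λ/v) ∫_{-vt}^{vt} x^p I₀((λ/v)√(v²t² − x²)) dx = (1 + (−1)^p) (vt)^p (2/(λt))^{(p−1)/2} Γ((p+1)/2) I_{(p+1)/2}(λt). -/
open Real

/-- The modified Bessel function of the first kind,
`I_ν(x) = ∑_{k=0}^∞ (x/2)^{2k+ν} / (Γ(k+1+ν) k!)`. -/
noncomputable def besselI (ν x : ℝ) : ℝ :=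
  ∑' k : ℕ, (x / 2) ^ (2 * (k : ℝ) + ν) / (Real.Gamma ((k : ℝ) + 1 + ν) * (Nat.factorial k))

theorem integral_pow_mul_sq_sub_sq_pow (a : ℝ) (k p : ℕ) :
    ∫ x in (-a)..a, x ^ p * (a ^ 2 - x ^ 2) ^ k =
      (1 + (-1 : ℝ) ^ p) / 2 * a ^ (p + 1 + 2 * k) *
        (Gamma (((p : ℝ) + 1) / 2) * k.factorial / Gamma ((k : ℝ) + 1 + ((p : ℝ) + 1) / 2)) := by
  induction k generalizing p with
  | zero =>
    have hq : (0 : ℝ) < ((p : ℝ) + 1) / 2 := by positivity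
    have hG := (Gamma_pos_of_pos hq).ne'
    simp only [pow_zero, mul_one, integral_pow, Nat.cast_zero, zero_add, Nat.factorial_zero,
      Nat.cast_one, mul_zero, add_zero]
    rw [add_comm 1 (((p : ℝ) + 1) / 2), Gamma_add_one hq.ne', neg_pow a]
    field_simp
    ring
  | succ k ih =>
    have hq : (0 : ℝ) < ((p : ℝ) + 1) / 2 := by positivity
    have hr : (0 : ℝ) < (k : ℝ) + 1 + ((p : ℝ) + 1) / 2 := by positivity
    have hG := (Gamma_pos_of_pos hr).ne'
    have hsplit : ∀ x : ℝ, x ^ p * (a ^ 2 - x ^ 2) ^ (k + 1) =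
        a ^ 2 * (x ^ p * (a ^ 2 - x ^ 2) ^ k) - x ^ (p + 2) * (a ^ 2 - x ^ 2) ^ k :=
      fun x => by ring
    simp only [hsplit]
    rw [intervalIntegral.integral_sub (Continuous.intervalIntegrable (by fun_prop) _ _)
      (Continuous.intervalIntegrable (by fun_prop) _ _), intervalIntegral.integral_const_mul,
      ih, ih]
    have e1 : (((p + 2 : ℕ) : ℝ) + 1) / 2 = ((p : ℝ) + 1) / 2 + 1 := by push_cast; ring
    have e2 : (k : ℝ) + 1 + (((p : ℝ) + 1) / 2 + 1) = (k : ℝ) + 1 + ((p : ℝ) + 1) / 2 + 1 := by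
      ring
    have e3 : ((k + 1 : ℕ) : ℝ) + 1 + ((p : ℝ) + 1) / 2 = (k : ℝ) + 1 + ((p : ℝ) + 1) / 2 + 1 := by
      push_cast; ring
    rw [e1, e2, e3, Gamma_add_one hq.ne', Gamma_add_one hr.ne', Nat.factorial_succ]
    push_cast
    field_simp
    ring

theorem besselI_zero_term {c y : ℝ} (hy : 0 ≤ y) (k : ℕ) :
    (c * √y / 2) ^ (2 * (k : ℝ) + 0) / (Gamma ((k : ℝ) + 1 + 0) * k.factorial) =
      ((c / 2) ^ 2) ^ k * y ^ k / (k.factorial : ℝ) ^ 2 := by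
  rw [add_zero, add_zero, Gamma_nat_eq_factorial,
    show (2 : ℝ) * k = ((2 * k : ℕ) : ℝ) by push_cast; ring, rpow_natCast, pow_mul, ← mul_pow,
    mul_div_right_comm, mul_pow, sq_sqrt hy, ← sq]

theorem summable_pow_div_factorial_sq (y : ℝ) :
    Summable fun k : ℕ => y ^ k / (k.factorial : ℝ) ^ 2 := by
  refine (summable_pow_div_factorial |y|).of_norm_bounded fun k => ?_
  have h : (1 : ℝ) ≤ k.factorial := by exact_mod_cast k.factorial_pos
  rw [norm_div, norm_pow, norm_pow, norm_eq_abs, RCLike.norm_natCast]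
  gcongr
  exact le_self_pow₀ h two_ne_zero

theorem hasSum_integral_pow_mul_besselI_zero {a : ℝ} (ha : 0 < a) (c : ℝ) (p : ℕ) :
    HasSum (fun k : ℕ => ∫ x in (-a)..a,
        ((c / 2) ^ 2) ^ k / (k.factorial : ℝ) ^ 2 * (x ^ p * (a ^ 2 - x ^ 2) ^ k))
      (∫ x in (-a)..a, x ^ p * besselI 0 (c * √(a ^ 2 - x ^ 2))) := by
  have hx : ∀ x ∈ Set.uIoc (-a) a, |x| ≤ a ∧ 0 ≤ a ^ 2 - x ^ 2 := by
    intro x hx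
    rw [Set.uIoc_of_le (by linarith)] at hx
    have h : |x| ≤ a := abs_le.2 ⟨hx.1.le, hx.2⟩
    exact ⟨h, sub_nonneg.2 (sq_le_sq' hx.1.le hx.2)⟩
  refine intervalIntegral.hasSum_integral_of_dominated_convergence
    (fun k _ => a ^ p * (((c / 2) ^ 2 * a ^ 2) ^ k / (k.factorial : ℝ) ^ 2)) ?_ ?_ ?_ ?_ ?_
  · exact fun k => Continuous.aestronglyMeasurable (by fun_prop)
  · refine fun k => Filter.Eventually.of_forall fun x h => ?_
    obtain ⟨h1, h2⟩ := hx x h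
    have h3 : a ^ 2 - x ^ 2 ≤ a ^ 2 := by linarith [sq_nonneg x]
    have h4 : 0 ≤ ((c / 2) ^ 2) ^ k / (k.factorial : ℝ) ^ 2 := by positivity
    rw [norm_mul, norm_mul, norm_of_nonneg h4,
      norm_of_nonneg (pow_nonneg h2 k), norm_pow, norm_eq_abs]
    calc ((c / 2) ^ 2) ^ k / (k.factorial : ℝ) ^ 2 * (|x| ^ p * (a ^ 2 - x ^ 2) ^ k)
        ≤ ((c / 2) ^ 2) ^ k / (k.factorial : ℝ) ^ 2 * (a ^ p * (a ^ 2) ^ k) := by gcongr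
      _ = _ := by rw [mul_pow ((c / 2) ^ 2)]; ring
  · exact Filter.Eventually.of_forall fun x _ => (summable_pow_div_factorial_sq _).mul_left _
  · exact intervalIntegrable_const
  · refine Filter.Eventually.of_forall fun x h => ?_
    obtain ⟨h1, h2⟩ := hx x h
    simp only [besselI, besselI_zero_term h2, ← mul_pow]
    have hterm : ∀ k : ℕ, ((c / 2) ^ 2) ^ k / (k.factorial : ℝ) ^ 2 *
        (x ^ p * (a ^ 2 - x ^ 2) ^ k) =
          x ^ p * (((c / 2) ^ 2 * (a ^ 2 - x ^ 2)) ^ k / (k.factorial : ℝ) ^ 2) :=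
      fun k => by rw [mul_pow ((c / 2) ^ 2)]; ring
    simp only [hterm]
    exact (summable_pow_div_factorial_sq _).hasSum.mul_left _

/-- `(λ/v) ∫_{-vt}^{vt} x^p I₀((λ/v)√(v²t² − x²)) dx
  = (1 + (−1)^p) (vt)^p (2/(λt))^{(p−1)/2} Γ((p+1)/2) I_{(p+1)/2}(λt)`. -/
theorem stmt_1 (l v t : ℝ) (hl : 0 < l) (hv : 0 < v) (ht : 0 < t)
    (p : ℕ) (hp : 1 ≤ p) :
    (l / v) * ∫ x in (-(v * t))..(v * t),
        x ^ p * besselI 0 ((l / v) * Real.sqrt (v ^ 2 * t ^ 2 - x ^ 2))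
      = (1 + (-1 : ℝ) ^ p) * (v * t) ^ p * (2 / (l * t)) ^ (((p : ℝ) - 1) / 2) *
          Real.Gamma (((p : ℝ) + 1) / 2) * besselI (((p : ℝ) + 1) / 2) (l * t) := by
  have key : ∀ k : ℕ, l / v * (∫ x in (-(v * t))..(v * t),
      ((l / v / 2) ^ 2) ^ k / (k.factorial : ℝ) ^ 2 * (x ^ p * ((v * t) ^ 2 - x ^ 2) ^ k)) =
      (1 + (-1 : ℝ) ^ p) * (v * t) ^ p * (2 / (l * t)) ^ (((p : ℝ) - 1) / 2) *
        Gamma (((p : ℝ) + 1) / 2) * ((l * t / 2) ^ (2 * (k : ℝ) + ((p : ℝ) + 1) / 2) /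
          (Gamma ((k : ℝ) + 1 + ((p : ℝ) + 1) / 2) * k.factorial)) := by
    intro k
    have hG := (Gamma_pos_of_pos
      (by positivity : (0 : ℝ) < (k : ℝ) + 1 + ((p : ℝ) + 1) / 2)).ne'
    have hpow : (2 / (l * t)) ^ (((p : ℝ) - 1) / 2) *
        (l * t / 2) ^ (2 * (k : ℝ) + ((p : ℝ) + 1) / 2) = (l * t / 2) ^ (2 * k + 1) := by
      rw [← inv_div (l * t) 2, inv_rpow (by positivity), ← rpow_neg (by positivity),
        ← rpow_add (by positivity), ← rpow_natCast]
      congr 1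
      push_cast
      ring
    rw [intervalIntegral.integral_const_mul, integral_pow_mul_sq_sub_sq_pow]
    calc _ = (1 + (-1 : ℝ) ^ p) * (v * t) ^ p * (l * t / 2) ^ (2 * k + 1) *
          Gamma (((p : ℝ) + 1) / 2) *
            (1 / (Gamma ((k : ℝ) + 1 + ((p : ℝ) + 1) / 2) * k.factorial)) := by
          obtain ⟨c, rfl⟩ : ∃ c, l = c * v := ⟨l / v, by field_simp⟩
          rw [mul_div_cancel_right₀ c hv.ne', show c * v * t / 2 = c / 2 * (v * t) by ring,
            ← pow_mul, mul_pow (c / 2)]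
          field_simp
          ring
      _ = _ := by rw [← hpow]; ring
  have hsum := (hasSum_integral_pow_mul_besselI_zero (mul_pos hv ht) (l / v) p).mul_left (l / v)
  simp only [key] at hsum
  rw [← mul_pow, ← hsum.tsum_eq, tsum_mul_left, besselI]
end

section
/- Let λ > 0, v > 0, t > 0 and let p ≥ 1 be a natural number. Then ∫_{-vt}^{vt} x^p · (e^{−λt}/(2v)) [ λ I₀((λ/v)√(v²t² − x²)) + λ v t I₁((λ/v)√(v²t² − x²)) / √(v²t² − x²) ] dx + (1 + (−1)^p) (vt)^p e^{−λt}/2 = (1 + (−1)^p) (vt)^p (2/(λt))^{(p−1)/2} Γ((p+1)/2) ( I_{(p+1)/2}(λt) + I_{(p−1)/2}(λt) ) e^{−λt}/2. (This is the p-th moment E X(t)^p of the telegraph process X(t) = V(0)∫₀ᵗ(−1)^{N(s)} ds, expressed analytically through its distribution, which has absolutely continuous density p(x,t) = (e^{−λt}/(2v))[λ I₀((λ/v)√(v²t²−x²)) + vλt I₁((λ/v)√(v²t²−x²))/√(v²t²−x²)] on (−vt, vt) and atoms of mass e^{−λt}/2 at ±vt.) -/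
open Real

/-- A Beta integral: `∫_{-c}^{c} x^p (c² - x²)^k dx` for even `p`. -/
theorem integral_even_pow_mul_sub_sq_pow (c : ℝ) (k : ℕ) {p : ℕ} (hp : Even p) :
    ∫ x in (-c)..c, x ^ p * (c ^ 2 - x ^ 2) ^ k =
      c ^ (p + 2 * k + 1) * Real.Gamma (((p : ℝ) + 1) / 2) * k.factorial /
        Real.Gamma (((p : ℝ) + 1) / 2 + k + 1) := by
  induction k generalizing p with
  | zero =>
    have hm : ((p : ℝ) + 1) / 2 ≠ 0 := by positivity
    have hG : Real.Gamma (((p : ℝ) + 1) / 2) ≠ 0 := (Real.Gamma_pos_of_pos (by positivity)).ne'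
    have hodd : (-c) ^ (p + 1) = -c ^ (p + 1) := hp.add_one.neg_pow c
    simp only [pow_zero, mul_one, integral_pow, hodd, Nat.cast_zero, add_zero, mul_zero,
      Nat.factorial_zero, Nat.cast_one, Real.Gamma_add_one hm]
    field_simp
    ring
  | succ k ih =>
    have hsplit : ∀ x : ℝ, x ^ p * (c ^ 2 - x ^ 2) ^ (k + 1) =
        c ^ 2 * (x ^ p * (c ^ 2 - x ^ 2) ^ k) - x ^ (p + 2) * (c ^ 2 - x ^ 2) ^ k :=
      fun x => by ring
    simp only [hsplit]
    rw [intervalIntegral.integral_sub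
      (Continuous.intervalIntegrable (by fun_prop) _ _)
      (Continuous.intervalIntegrable (by fun_prop) _ _),
      intervalIntegral.integral_const_mul, ih hp, ih (hp.add even_two)]
    set m : ℝ := ((p : ℝ) + 1) / 2 with hm
    have hm0 : 0 < m := by positivity
    have hm1 : (((p + 2 : ℕ) : ℝ) + 1) / 2 = m + 1 := by push_cast [hm]; ring
    have hG : Real.Gamma (m + k + 1) ≠ 0 := (Real.Gamma_pos_of_pos (by positivity)).ne'
    have hk : m + k + 1 ≠ 0 := by positivity
    rw [hm1, Real.Gamma_add_one hm0.ne', show m + 1 + k + 1 = m + k + 1 + 1 by ring,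
      show m + ((k + 1 : ℕ) : ℝ) + 1 = m + k + 1 + 1 by push_cast; ring,
      Real.Gamma_add_one hk, Nat.factorial_succ]
    push_cast
    field_simp
    ring

/-- Termwise integration against `x^p` of a power series in `c² - x²`. -/
theorem hasSum_integral_pow_mul_of_hasSum {c : ℝ} (hc : 0 ≤ c) (p : ℕ) {q : ℕ → ℝ} {g : ℝ → ℝ}
    (hq : Summable fun k => |q k| * (c ^ 2) ^ k)
    (hg : ∀ x ∈ Set.Ioo (-c) c, HasSum (fun k => q k * (c ^ 2 - x ^ 2) ^ k) (g x)) :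
    HasSum (fun k => q k * ∫ x in (-c)..c, x ^ p * (c ^ 2 - x ^ 2) ^ k)
      (∫ x in (-c)..c, x ^ p * g x) := by
  simp only [← intervalIntegral.integral_const_mul]
  refine intervalIntegral.hasSum_integral_of_dominated_convergence
    (fun k _ => c ^ p * (|q k| * (c ^ 2) ^ k))
    (fun k => Continuous.aestronglyMeasurable (by fun_prop)) (fun k => ?_) ?_ ?_ ?_
  · refine Filter.Eventually.of_forall fun x hx => ?_
    rw [Set.uIoc_of_le (by linarith)] at hx
    have hxc : |x| ≤ c := abs_le.2 ⟨hx.1.le, hx.2⟩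
    have hsq : x ^ 2 ≤ c ^ 2 := sq_le_sq' hx.1.le hx.2
    rw [Real.norm_eq_abs, abs_mul, abs_mul, abs_pow, abs_pow, abs_of_nonneg (sub_nonneg.2 hsq),
      mul_left_comm]
    gcongr
    linarith [sq_nonneg x]
  · exact Filter.Eventually.of_forall fun _ _ => hq.mul_left _
  · exact intervalIntegrable_const
  · filter_upwards [MeasureTheory.compl_mem_ae_iff.2
      (MeasureTheory.measure_singleton (μ := MeasureTheory.volume) c)] with x hxc hx
    rw [Set.uIoc_of_le (by linarith)] at hx
    have := (hg x ⟨hx.1, lt_of_le_of_ne hx.2 hxc⟩).mul_left (x ^ p)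
    simpa only [mul_left_comm] using this

theorem summable_pow_div_factorial_mul_factorial (n : ℕ) (b : ℝ) (hb : 0 ≤ b) :
    Summable fun k : ℕ => b ^ k / ((k + n).factorial * k.factorial : ℝ) := by
  refine (Real.summable_pow_div_factorial b).of_nonneg_of_le (fun k => by positivity) fun k => ?_
  gcongr
  exact le_mul_of_one_le_left (by positivity) (by exact_mod_cast (k + n).factorial_pos)

/-- The series of `I_n(a s) / s^n` at an integer order, in powers of `s²`. -/
theorem hasSum_besselI_nat_div_pow (n : ℕ) {a s : ℝ} (ha : 0 < a) (hs : 0 < s) :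
    HasSum (fun k : ℕ => (a / 2) ^ (2 * k + n) / ((k + n).factorial * k.factorial) * (s ^ 2) ^ k)
      (besselI n (a * s) / s ^ n) := by
  have hterm : ∀ k : ℕ,
      (a / 2) ^ (2 * k + n) / ((k + n).factorial * k.factorial) * (s ^ 2) ^ k =
        (a * s / 2) ^ (2 * (k : ℝ) + n) / (Real.Gamma ((k : ℝ) + 1 + n) * k.factorial) / s ^ n := by
    intro k
    rw [show (2 * (k : ℝ) + n) = ((2 * k + n : ℕ) : ℝ) by push_cast; ring, Real.rpow_natCast,
      show (k : ℝ) + 1 + n = ((k + n : ℕ) : ℝ) + 1 by push_cast; ring,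
      Real.Gamma_nat_eq_factorial]
    field_simp
    ring
  have hsum := (summable_pow_div_factorial_mul_factorial n ((a / 2 * s) ^ 2)
    (by positivity)).mul_left ((a / 2) ^ n)
  have hsum' : Summable fun k : ℕ =>
      (a / 2) ^ (2 * k + n) / ((k + n).factorial * k.factorial) * (s ^ 2) ^ k :=
    hsum.congr fun k => by generalize a / 2 = d; ring
  convert hsum'.hasSum using 1
  simp only [hterm, tsum_div_const]
  rfl

/-- The power of `z / 2` factors out of the Bessel series. -/
theorem besselI_eq_rpow_mul_tsum {z : ℝ} (hz : 0 < z) (ν : ℝ) (j : ℕ) :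
    besselI (ν + j) z = (z / 2) ^ ν *
      ∑' k : ℕ, (z / 2) ^ (2 * k + j) / (Real.Gamma (ν + j + k + 1) * k.factorial) := by
  rw [besselI, ← tsum_mul_left]
  refine tsum_congr fun k => ?_
  rw [show 2 * (k : ℝ) + (ν + j) = ν + ((2 * k + j : ℕ) : ℝ) by push_cast; ring,
    Real.rpow_add (by positivity), Real.rpow_natCast, mul_div_assoc,
    show (k : ℝ) + 1 + (ν + j) = ν + j + k + 1 by ring]

/-- the `p`-th moment of the telegraph process, computed from its
density (absolutely continuous part on `(−vt, vt)` plus atoms of mass `e^{−λt}/2`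
at `±vt`), equals
`(1 + (−1)^p) (vt)^p (2/(λt))^{(p−1)/2} Γ((p+1)/2)
  (I_{(p+1)/2}(λt) + I_{(p−1)/2}(λt)) e^{−λt}/2`. -/
theorem stmt_3 (l v t : ℝ) (hl : 0 < l) (hv : 0 < v) (ht : 0 < t)
    (p : ℕ) (hp : 1 ≤ p) :
    (∫ x in (-(v * t))..(v * t),
        x ^ p * (Real.exp (-(l * t)) / (2 * v)) *
          (l * besselI 0 ((l / v) * Real.sqrt (v ^ 2 * t ^ 2 - x ^ 2)) +
            l * v * t * besselI 1 ((l / v) * Real.sqrt (v ^ 2 * t ^ 2 - x ^ 2)) /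
              Real.sqrt (v ^ 2 * t ^ 2 - x ^ 2)))
      + (1 + (-1 : ℝ) ^ p) * (v * t) ^ p * Real.exp (-(l * t)) / 2
      = (1 + (-1 : ℝ) ^ p) * (v * t) ^ p * (2 / (l * t)) ^ (((p : ℝ) - 1) / 2) *
          Real.Gamma (((p : ℝ) + 1) / 2) *
          (besselI (((p : ℝ) + 1) / 2) (l * t) + besselI (((p : ℝ) - 1) / 2) (l * t)) *
          (Real.exp (-(l * t)) / 2) := by
  rcases Nat.even_or_odd p with hpe | hpo
  swap
  · have hneg : ∀ g : ℝ → ℝ, (∀ x, g (-x) = -g x) → ∫ x in (-(v * t))..(v * t), g x = 0 := by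
      intro g hg
      have h := intervalIntegral.integral_comp_neg (a := -(v * t)) (b := v * t) g
      simp only [hg, neg_neg, intervalIntegral.integral_neg] at h
      linarith
    rw [hneg _ fun x => by simp only [hpo.neg_pow, neg_sq, neg_mul], hpo.neg_one_pow]
    ring
  rw [hpe.neg_one_pow]
  set c : ℝ := v * t with hc
  set z : ℝ := l * t with hz
  set m : ℝ := ((p : ℝ) + 1) / 2 with hm
  have hc0 : 0 < c := by positivity
  have hz0 : 0 < z := by positivity
  have hm0 : 0 < m := by positivity
  have hm1 : ((p : ℝ) - 1) / 2 = m - 1 := by rw [hm]; ring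
  rw [hm1]
  set K : ℝ := Real.exp (-z) / (2 * v) with hK
  have hK0 : 0 < K := by positivity
  set a : ℝ := l / v with ha
  have ha0 : 0 < a := by positivity
  clear_value c z m K a
  let b : ℕ → ℕ → ℝ := fun n k => (a / 2) ^ (2 * k + n) / ((k + n).factorial * k.factorial)
  have hb0 : ∀ n k, 0 < b n k := fun n k => by positivity
  have hb : ∀ n, Summable fun k => b n k * (c ^ 2) ^ k := fun n =>
    (hasSum_besselI_nat_div_pow n ha0 hc0).summable
  let q : ℕ → ℝ := fun k => K * (l * b 0 k + l * c * b 1 k)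
  have hq0 : ∀ k, 0 < q k := fun k => by
    have := hb0 0 k
    have := hb0 1 k
    positivity
  have hq : Summable fun k => |q k| * (c ^ 2) ^ k := by
    refine (((hb 0).mul_left (K * l)).add ((hb 1).mul_left (K * l * c))).congr fun k => ?_
    rw [abs_of_pos (hq0 k)]
    ring
  have hmain := hasSum_integral_pow_mul_of_hasSum hc0.le p (q := q)
    (g := fun x => K * (l * besselI 0 (a * Real.sqrt (v ^ 2 * t ^ 2 - x ^ 2)) +
      l * v * t * besselI 1 (a * Real.sqrt (v ^ 2 * t ^ 2 - x ^ 2)) /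
        Real.sqrt (v ^ 2 * t ^ 2 - x ^ 2))) hq (by
    intro x hx
    have hw : 0 < c ^ 2 - x ^ 2 := sub_pos.2 (sq_lt_sq' hx.1 hx.2)
    rw [show v ^ 2 * t ^ 2 - x ^ 2 = c ^ 2 - x ^ 2 by rw [hc]; ring]
    have hs := Real.sqrt_pos.2 hw
    have h0 := hasSum_besselI_nat_div_pow 0 ha0 hs
    have h1 := hasSum_besselI_nat_div_pow 1 ha0 hs
    rw [Real.sq_sqrt hw.le] at h0 h1
    rw [Nat.cast_zero, pow_zero, div_one] at h0
    rw [Nat.cast_one, pow_one] at h1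
    have h := ((h0.mul_left (K * l)).add (h1.mul_left (K * l * c))).congr_fun
      (g := fun k => q k * (c ^ 2 - x ^ 2) ^ k) fun k => by simp only [q, b]; ring
    have hval : ∀ B₀ B₁ s : ℝ, K * (l * B₀ + l * v * t * B₁ / s) =
        K * l * B₀ + K * l * c * (B₁ / s) := fun B₀ B₁ s => by rw [hc]; ring
    rw [hval]
    exact h)
  simp only [integral_even_pow_mul_sub_sq_pow c _ hpe, ← hm, ← mul_assoc (_ ^ p) K] at hmain
  let U : ℕ → ℝ := fun k => (z / 2) ^ (2 * k + 1) / (Real.Gamma (m + k + 1) * k.factorial)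
  let V : ℕ → ℝ := fun k => (z / 2) ^ (2 * k) / (Real.Gamma (m + k) * k.factorial)
  set D : ℝ := Real.exp (-z) * c ^ p * Real.Gamma m with hD
  have hGm : 0 < Real.Gamma m := Real.Gamma_pos_of_pos hm0
  have hD0 : 0 < D := by positivity
  have hU0 : ∀ k, 0 ≤ U k := fun k => by
    have : 0 < Real.Gamma (m + k + 1) := Real.Gamma_pos_of_pos (by positivity)
    positivity
  have hV0 : ∀ k, 0 ≤ V k := fun k => by
    have : 0 < Real.Gamma (m + k) := Real.Gamma_pos_of_pos (by positivity)
    positivity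
  have hterm : ∀ k : ℕ, q k * (c ^ (p + 2 * k + 1) * Real.Gamma m * k.factorial /
      Real.Gamma (m + k + 1)) = D * (U k + V (k + 1)) := by
    intro k
    have hG : Real.Gamma (m + k + 1) ≠ 0 := (Real.Gamma_pos_of_pos (by positivity)).ne'
    have hzc : z = a * c := by rw [hz, ha, hc]; field_simp
    have hlv : l = a * v := by rw [ha]; field_simp
    simp only [q, b, U, V, hD, hK]
    rw [show m + ((k + 1 : ℕ) : ℝ) = m + k + 1 by push_cast; ring, add_zero,
      Nat.factorial_succ, hlv]
    generalize Real.exp (-z) = E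
    rw [hzc]
    have hk : (k.factorial : ℝ) ≠ 0 := by positivity
    push_cast
    generalize (k.factorial : ℝ) = F at hk ⊢
    field_simp
    ring
  simp only [hterm] at hmain
  have hUV : Summable fun k => U k + V (k + 1) :=
    (summable_mul_left_iff hD0.ne').1 hmain.summable
  have hU : Summable U := hUV.of_nonneg_of_le hU0 fun k => by linarith [hV0 (k + 1)]
  have hV1 : Summable fun k => V (k + 1) :=
    hUV.of_nonneg_of_le (fun k => hV0 (k + 1)) fun k => by linarith [hU0 k]
  have hV : Summable V := (summable_nat_add_iff 1).1 hV1
  have hBU : besselI m z = (z / 2) ^ (m - 1) * ∑' k, U k := by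
    simpa [U] using besselI_eq_rpow_mul_tsum hz0 (m - 1) 1
  have hBV : besselI (m - 1) z = (z / 2) ^ (m - 1) * ∑' k, V k := by
    have h := besselI_eq_rpow_mul_tsum hz0 (m - 1) 0
    simp only [Nat.cast_zero, add_zero] at h
    rw [h]
    congr 1
    refine tsum_congr fun k => ?_
    rw [show m - 1 + (k : ℝ) + 1 = m + k by ring]
  have hone : (2 / z) ^ (m - 1) * (z / 2) ^ (m - 1) = 1 := by
    rw [← Real.mul_rpow (by positivity) (by positivity),
      show 2 / z * (z / 2) = 1 by field_simp, Real.one_rpow]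
  have hVz : D * V 0 = Real.exp (-z) * c ^ p := by
    simp only [V, hD]
    simp [hGm.ne']
  rw [← hmain.tsum_eq, tsum_mul_left, hU.tsum_add hV1, hBU, hBV]
  have hVs := hV.tsum_eq_zero_add
  calc _ = D * (∑' k, U k + (V 0 + ∑' k, V (k + 1))) := by linear_combination -hVz
    _ = D * (∑' k, U k + ∑' k, V k) := by rw [hVs]
    _ = _ := by linear_combination (-D * (∑' k, U k + ∑' k, V k)) * hone
end

section
/- Let λ > 0, v > 0, t > 0. Then (vt)⁴ (2/(λt))^{3/2} Γ(5/2) e^{−λt} ( I_{5/2}(λt) + I_{3/2}(λt) ) = 3 (v/λ)⁴ e^{−λt} [ λt (λt − 3) cosh(λt) + (3 + λt(λt − 1)) sinh(λt) ]. (This gives the closed form of the fourth moment E X(t)⁴ of the telegraph process.) -/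
open Real

theorem gamma_add_three_halves_mul_factorial (k : ℕ) :
    Real.Gamma ((k : ℝ) + 3 / 2) * (Nat.factorial k) =
      (Nat.factorial (2 * k + 1)) * √π / (2 * 4 ^ k) := by
  have h := Real.Gamma_mul_Gamma_add_half ((k : ℝ) + 1)
  rw [Real.Gamma_nat_eq_factorial, show (k : ℝ) + 1 + 1 / 2 = k + 3 / 2 by ring,
    show 2 * ((k : ℝ) + 1) = ((2 * k + 1 : ℕ) : ℝ) + 1 by push_cast; ring,
    Real.Gamma_nat_eq_factorial,
    show (1 : ℝ) - (((2 * k + 1 : ℕ) : ℝ) + 1) = -((2 * k + 1 : ℕ) : ℝ) by push_cast; ring,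
    Real.rpow_neg two_pos.le, Real.rpow_natCast, pow_succ, pow_mul] at h
  rw [mul_comm, h]
  norm_num
  field_simp

theorem gamma_add_five_halves_mul_factorial (k : ℕ) :
    Real.Gamma ((k : ℝ) + 5 / 2) * (Nat.factorial k) =
      (2 * k + 3) * (Nat.factorial (2 * k + 1)) * √π / (4 * 4 ^ k) := by
  rw [show (k : ℝ) + 5 / 2 = k + 3 / 2 + 1 by ring, Real.Gamma_add_one (by positivity),
    mul_assoc, gamma_add_three_halves_mul_factorial]
  field_simp
  ring

theorem gamma_add_seven_halves_mul_factorial (k : ℕ) :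
    Real.Gamma ((k : ℝ) + 7 / 2) * (Nat.factorial k) =
      (2 * k + 5) * (2 * k + 3) * (Nat.factorial (2 * k + 1)) * √π / (8 * 4 ^ k) := by
  rw [show (k : ℝ) + 7 / 2 = k + 5 / 2 + 1 by ring, Real.Gamma_add_one (by positivity),
    mul_assoc, gamma_add_five_halves_mul_factorial]
  field_simp
  ring

theorem half_rpow_two_mul_add {x : ℝ} (hx : 0 < x) (k : ℕ) (ν : ℝ) :
    (x / 2) ^ (2 * (k : ℝ) + ν) = x ^ (2 * k) / 4 ^ k * (x / 2) ^ ν := by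
  rw [Real.rpow_add (by positivity), show 2 * (k : ℝ) = ((2 * k : ℕ) : ℝ) by push_cast; rfl,
    Real.rpow_natCast, div_pow, pow_mul 2]
  norm_num

theorem besselI_three_halves {x : ℝ} (hx : 0 < x) :
    besselI (3 / 2) x =
      (x / 2) ^ ((3 : ℝ) / 2) * 4 / √π * (Real.cosh x / x ^ 2 - Real.sinh x / x ^ 3) := by
  have hc := ((hasSum_nat_add_iff' 1).2 (Real.hasSum_cosh x)).div_const (x ^ 2)
  have hs := ((hasSum_nat_add_iff' 1).2 (Real.hasSum_sinh x)).div_const (x ^ 3)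
  have h := (hc.sub hs).mul_left ((x / 2) ^ ((3 : ℝ) / 2) * 4 / √π)
  have hπ : √π ≠ 0 := by positivity
  unfold besselI
  convert h.tsum_eq using 1
  · refine tsum_congr fun k => ?_
    rw [half_rpow_two_mul_add hx, show (k : ℝ) + 1 + 3 / 2 = k + 5 / 2 by ring,
      gamma_add_five_halves_mul_factorial]
    simp only [show 2 * (k + 1) = 2 * k + 1 + 1 by ring, Nat.factorial_succ (2 * k + 1),
      Nat.factorial_succ (2 * k + 1 + 1)]
    push_cast
    field_simp
    ring
  · congr 1
    simp
    field_simp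
    ring

theorem besselI_five_halves {x : ℝ} (hx : 0 < x) :
    besselI (5 / 2) x = (x / 2) ^ ((5 : ℝ) / 2) * 8 / √π *
      (Real.sinh x / x ^ 3 - 3 * Real.cosh x / x ^ 4 + 3 * Real.sinh x / x ^ 5) := by
  have hs := ((hasSum_nat_add_iff' 1).2 (Real.hasSum_sinh x)).div_const (x ^ 3)
  have hc := (((hasSum_nat_add_iff' 2).2 (Real.hasSum_cosh x)).mul_left 3).div_const (x ^ 4)
  have hs' := (((hasSum_nat_add_iff' 2).2 (Real.hasSum_sinh x)).mul_left 3).div_const (x ^ 5)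
  have h := ((hs.sub hc).add hs').mul_left ((x / 2) ^ ((5 : ℝ) / 2) * 8 / √π)
  have hπ : √π ≠ 0 := by positivity
  unfold besselI
  convert h.tsum_eq using 1
  · refine tsum_congr fun k => ?_
    rw [half_rpow_two_mul_add hx, show (k : ℝ) + 1 + 5 / 2 = k + 7 / 2 by ring,
      gamma_add_seven_halves_mul_factorial]
    simp only [show 2 * (k + 1) = 2 * k + 1 + 1 by ring,
      show 2 * (k + 2) = 2 * k + 1 + 1 + 1 + 1 by ring, Nat.factorial_succ (2 * k + 1),
      Nat.factorial_succ (2 * k + 1 + 1), Nat.factorial_succ (2 * k + 1 + 1 + 1),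
      Nat.factorial_succ (2 * k + 1 + 1 + 1 + 1)]
    push_cast
    field_simp
    ring
  · congr 1
    simp [Finset.sum_range_succ, Nat.factorial]
    field_simp
    ring

/-- the closed form of the fourth moment of the telegraph process:
`(vt)⁴ (2/(λt))^{3/2} Γ(5/2) e^{−λt} (I_{5/2}(λt) + I_{3/2}(λt))
  = 3 (v/λ)⁴ e^{−λt} [λt(λt − 3) cosh(λt) + (3 + λt(λt − 1)) sinh(λt)]`. -/
theorem stmt_8 (l v t : ℝ) (hl : 0 < l) (hv : 0 < v) (ht : 0 < t) :
    (v * t) ^ 4 * (2 / (l * t)) ^ ((3 : ℝ) / 2) * Real.Gamma (5 / 2) *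
        Real.exp (-(l * t)) * (besselI (5 / 2) (l * t) + besselI (3 / 2) (l * t))
      = 3 * (v / l) ^ 4 * Real.exp (-(l * t)) *
          (l * t * (l * t - 3) * Real.cosh (l * t) +
            (3 + l * t * (l * t - 1)) * Real.sinh (l * t)) := by
  have hx : 0 < l * t := by positivity
  have hΓ : Real.Gamma (5 / 2) = 3 / 4 * √π := by
    have h := gamma_add_five_halves_mul_factorial 0
    norm_num at h
    rw [h]
    ring
  have hpow : (l * t / 2) ^ ((5 : ℝ) / 2) = (l * t / 2) ^ ((3 : ℝ) / 2) * (l * t / 2) := by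
    rw [show (5 : ℝ) / 2 = 3 / 2 + 1 by norm_num, Real.rpow_add_one (by positivity)]
  have hinv : (2 / (l * t)) ^ ((3 : ℝ) / 2) = ((l * t / 2) ^ ((3 : ℝ) / 2))⁻¹ := by
    rw [← Real.inv_rpow (by positivity), inv_div]
  have hp : (l * t / 2) ^ ((3 : ℝ) / 2) ≠ 0 := by positivity
  have hπ : √π ≠ 0 := by positivity
  rw [besselI_three_halves hx, besselI_five_halves hx, hΓ, hpow, hinv]
  generalize (l * t / 2) ^ ((3 : ℝ) / 2) = p at hp ⊢
  field_simp
  ring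
end

section
/- Let λ > 0 and v > 0. Then, as t → 0⁺, (vt)⁶ (2/(λt))^{5/2} Γ(7/2) e^{−λt} ( I_{7/2}(λt) + I_{5/2}(λt) ) − ( v⁶ t⁶ − (6/7) v⁶ λ t⁷ + (3/7) v⁶ λ² t⁸ ) = o(t⁸). -/
open Real Asymptotics

open Filter Topology

lemma Gamma_le_Gamma_natCast_add {ν : ℝ} (hν : 0 ≤ ν) (k : ℕ) :
    Real.Gamma (1 + ν) ≤ Real.Gamma ((k : ℝ) + 1 + ν) := by
  induction k with
  | zero => simp
  | succ k ih =>
    have hk : 0 < (k : ℝ) + 1 + ν := by positivity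
    have h1 : ((k + 1 : ℕ) : ℝ) + 1 + ν = ((k : ℝ) + 1 + ν) + 1 := by push_cast; ring
    rw [h1, Real.Gamma_add_one hk.ne']
    have hpos := Real.Gamma_pos_of_pos hk
    have hk1 : 1 ≤ (k : ℝ) + 1 + ν := by
      have : (0 : ℝ) ≤ k := k.cast_nonneg
      linarith
    nlinarith

lemma summable_inv_Gamma_mul_factorial {ν : ℝ} (hν : 0 ≤ ν) :
    Summable fun k : ℕ => 1 / (Real.Gamma ((k : ℝ) + 1 + ν) * (Nat.factorial k)) := by
  have hG : 0 < Real.Gamma (1 + ν) := Real.Gamma_pos_of_pos (by positivity)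
  have hs : Summable fun k : ℕ => 1 / Real.Gamma (1 + ν) * ((1 : ℝ) ^ k / (Nat.factorial k)) :=
    (Real.summable_pow_div_factorial 1).mul_left _
  refine Summable.of_nonneg_of_le (fun k => ?_) (fun k => ?_) hs
  · have := Real.Gamma_pos_of_pos (show 0 < (k : ℝ) + 1 + ν by positivity)
    positivity
  · rw [one_pow, div_mul_div_comm, one_mul]
    gcongr
    exact Gamma_le_Gamma_natCast_add hν k

/-- The power series of `I_ν`, normalised by `(x/2)^(-ν)`, to second order at `0`. -/
lemma besselI_mul_rpow_sub_isBigO {ν : ℝ} (hν : 0 ≤ ν) :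
    (fun x : ℝ => besselI ν x * (2 / x) ^ ν -
        (1 / Real.Gamma (1 + ν) + 1 / Real.Gamma (2 + ν) * (x / 2) ^ 2))
      =O[𝓝[>] 0] fun x : ℝ => x ^ 4 := by
  set c : ℕ → ℝ := fun k => 1 / (Real.Gamma ((k : ℝ) + 1 + ν) * (Nat.factorial k)) with hc
  have hcs : Summable c := summable_inv_Gamma_mul_factorial hν
  have hc0 : ∀ k, 0 ≤ c k := fun k => by
    have := Real.Gamma_pos_of_pos (show 0 < (k : ℝ) + 1 + ν by positivity)
    simp only [hc]
    positivity
  have hcs2 : Summable fun k => c (k + 2) := (summable_nat_add_iff 2).2 hcs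
  refine IsBigO.of_bound (∑' k, c (k + 2)) ?_
  filter_upwards [Ioo_mem_nhdsGT (show (0 : ℝ) < 1 by norm_num)] with x hx
  obtain ⟨hx0, hx1⟩ := hx
  have hy0 : 0 < x / 2 := by positivity
  have hy1 : x / 2 ≤ 1 := by linarith
  have hle : ∀ k : ℕ, c k * (x / 2) ^ (2 * k) ≤ c k := fun k =>
    mul_le_of_le_one_right (hc0 k) (pow_le_one₀ hy0.le hy1)
  have hs : Summable fun k => c k * (x / 2) ^ (2 * k) :=
    Summable.of_nonneg_of_le (fun k => mul_nonneg (hc0 k) (by positivity)) hle hcs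
  have hone : (x / 2) ^ ν * (2 / x) ^ ν = 1 := by
    rw [← Real.mul_rpow hy0.le (by positivity), show x / 2 * (2 / x) = 1 by field_simp,
      Real.one_rpow]
  have hI : besselI ν x * (2 / x) ^ ν = ∑' k, c k * (x / 2) ^ (2 * k) := by
    rw [besselI, ← tsum_mul_right]
    refine tsum_congr fun k => ?_
    rw [Real.rpow_add hy0, show (2 * (k : ℝ)) = ((2 * k : ℕ) : ℝ) by push_cast; ring,
      Real.rpow_natCast]
    simp only [hc]
    linear_combination (1 / (Real.Gamma ((k : ℝ) + 1 + ν) * (Nat.factorial k))) *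
      (x / 2) ^ (2 * k) * hone
  have hsplit := hs.sum_add_tsum_nat_add 2
  have htail : ∑' k, c (k + 2) * (x / 2) ^ (2 * (k + 2)) ≤ (∑' k, c (k + 2)) * x ^ 4 := by
    rw [← tsum_mul_right]
    refine ((summable_nat_add_iff 2).2 hs).tsum_le_tsum (fun k => ?_) (hcs2.mul_right _)
    refine mul_le_mul_of_nonneg_left ?_ (hc0 _)
    calc (x / 2) ^ (2 * (k + 2)) ≤ (x / 2) ^ 4 :=
          pow_le_pow_of_le_one hy0.le hy1 (by omega)
      _ ≤ x ^ 4 := by gcongr; linarith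
  have htail0 : 0 ≤ ∑' k, c (k + 2) * (x / 2) ^ (2 * (k + 2)) :=
    tsum_nonneg fun k => mul_nonneg (hc0 _) (by positivity)
  have heq : besselI ν x * (2 / x) ^ ν -
      (1 / Real.Gamma (1 + ν) + 1 / Real.Gamma (2 + ν) * (x / 2) ^ 2) =
      ∑' k, c (k + 2) * (x / 2) ^ (2 * (k + 2)) := by
    have h0 : c 0 = 1 / Real.Gamma (1 + ν) := by simp [hc]
    have h1 : c 1 = 1 / Real.Gamma (2 + ν) := by
      simp only [hc]; norm_num
    rw [hI, ← hsplit, Finset.sum_range_succ, Finset.sum_range_one, h0, h1]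
    ring
  rw [heq, Real.norm_of_nonneg htail0, Real.norm_of_nonneg (by positivity)]
  exact htail

lemma pow_isBigO_pow_nhdsGT_zero {m n : ℕ} (h : m ≤ n) :
    (fun x : ℝ => x ^ n) =O[𝓝[>] 0] fun x : ℝ => x ^ m := by
  refine IsBigO.of_bound 1 ?_
  filter_upwards [Ioo_mem_nhdsGT (show (0 : ℝ) < 1 by norm_num)] with x hx
  rw [one_mul, norm_pow, norm_pow, Real.norm_of_nonneg hx.1.le]
  exact pow_le_pow_of_le_one hx.1.le hx.2.le h

lemma besselI_sum_sub_isBigO :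
    (fun x : ℝ => (2 / x) ^ ((5 : ℝ) / 2) * Real.Gamma (7 / 2) *
        (besselI (7 / 2) x + besselI (5 / 2) x) - (1 + x / 7 + x ^ 2 / 14))
      =O[𝓝[>] 0] fun x : ℝ => x ^ 3 := by
  have hG : Real.Gamma (7 / 2) ≠ 0 := (Real.Gamma_pos_of_pos (by norm_num)).ne'
  have hG9 : Real.Gamma (9 / 2) = 7 / 2 * Real.Gamma (7 / 2) := by
    rw [← Real.Gamma_add_one (by norm_num)]; norm_num
  have hG11 : Real.Gamma (11 / 2) = 9 / 2 * (7 / 2 * Real.Gamma (7 / 2)) := by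
    rw [← hG9, ← Real.Gamma_add_one (by norm_num)]; norm_num
  have h5 := (besselI_mul_rpow_sub_isBigO (ν := 5 / 2) (by norm_num)).trans
    (pow_isBigO_pow_nhdsGT_zero (show 3 ≤ 4 by norm_num))
  have h7 := (besselI_mul_rpow_sub_isBigO (ν := 7 / 2) (by norm_num)).trans
    (pow_isBigO_pow_nhdsGT_zero (show 2 ≤ 4 by norm_num))
  have h7' := ((isBigO_refl (fun x : ℝ => x) (𝓝[>] 0)).mul h7).const_mul_left
    (Real.Gamma (7 / 2) / 2)
  have hcube := (isBigO_refl (fun x : ℝ => x ^ 3) (𝓝[>] 0)).const_mul_left (1 / 126)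
  have h7'' := h7'.congr_right (g₂ := fun x : ℝ => x ^ 3) (fun x => by ring)
  refine (((h5.const_mul_left (Real.Gamma (7 / 2))).add h7'').add hcube).congr' ?_ .rfl
  filter_upwards [self_mem_nhdsWithin] with x hx
  have hx0 : 0 < x := hx
  have hr : (2 / x) ^ ((7 : ℝ) / 2) = (2 / x) ^ ((5 : ℝ) / 2) * (2 / x) := by
    rw [show (7 : ℝ) / 2 = 5 / 2 + 1 by norm_num, Real.rpow_add_one (by positivity)]
  rw [hr, show (1 : ℝ) + 5 / 2 = 7 / 2 by norm_num, show (2 : ℝ) + 5 / 2 = 9 / 2 by norm_num,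
    show (1 : ℝ) + 7 / 2 = 9 / 2 by norm_num, show (2 : ℝ) + 7 / 2 = 11 / 2 by norm_num, hG9, hG11]
  field_simp
  ring

lemma exp_neg_mul_besselI_sum_sub_isBigO :
    (fun x : ℝ => (2 / x) ^ ((5 : ℝ) / 2) * Real.Gamma (7 / 2) * Real.exp (-x) *
        (besselI (7 / 2) x + besselI (5 / 2) x) - (1 - 6 / 7 * x + 3 / 7 * x ^ 2))
      =O[𝓝[>] 0] fun x : ℝ => x ^ 3 := by
  have hneg : Tendsto (fun x : ℝ => -x) (𝓝[>] 0) (𝓝 0) := by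
    have : ContinuousAt (fun x : ℝ => -x) 0 := by fun_prop
    simpa using this.tendsto.mono_left nhdsWithin_le_nhds
  have hE : (fun x : ℝ => Real.exp (-x) - (1 - x + x ^ 2 / 2)) =O[𝓝[>] 0] fun x : ℝ => x ^ 3 := by
    refine (((Real.exp_sub_sum_range_isBigO_pow 3).comp_tendsto hneg).trans
      (IsBigO.of_bound 1 (.of_forall fun x => ?_))).congr_left fun x => ?_
    · simp
    · simp [Finset.sum_range_succ, sub_eq_add_neg]
  have hbdd : ∀ f : ℝ → ℝ, Continuous f → f =O[𝓝[>] 0] fun _ : ℝ => (1 : ℝ) := fun f hf =>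
    (hf.continuousAt.tendsto.mono_left nhdsWithin_le_nhds).isBigO_one ℝ
  have h1 := besselI_sum_sub_isBigO.mul (hbdd (fun x => Real.exp (-x)) (by fun_prop))
  have h2 := hE.mul (hbdd (fun x => 1 + x / 7 + x ^ 2 / 14) (by fun_prop))
  have h3 := (isBigO_refl (fun x : ℝ => x ^ 3) (𝓝[>] 0)).mul
    (hbdd (fun x => x / 28) (by fun_prop))
  refine ((h1.add h2).add h3).congr (fun x => ?_) fun x => by ring
  ring

/-- as `t → 0⁺`,
`(vt)⁶ (2/(λt))^{5/2} Γ(7/2) e^{−λt} (I_{7/2}(λt) + I_{5/2}(λt))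
  − (v⁶t⁶ − (6/7)v⁶λt⁷ + (3/7)v⁶λ²t⁸) = o(t⁸)`. -/
theorem stmt_11 (l v : ℝ) (hl : 0 < l) (hv : 0 < v) :
    (fun t : ℝ =>
        (v * t) ^ 6 * (2 / (l * t)) ^ ((5 : ℝ) / 2) * Real.Gamma (7 / 2) *
            Real.exp (-(l * t)) * (besselI (7 / 2) (l * t) + besselI (5 / 2) (l * t)) -
          (v ^ 6 * t ^ 6 - 6 / 7 * v ^ 6 * l * t ^ 7 + 3 / 7 * v ^ 6 * l ^ 2 * t ^ 8))
      =o[nhdsWithin 0 (Set.Ioi 0)] fun t : ℝ => t ^ 8 := by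
  have hlt : Tendsto (fun t : ℝ => l * t) (𝓝[>] 0) (𝓝[>] 0) := by
    refine tendsto_nhdsWithin_iff.2 ⟨?_, ?_⟩
    · have : ContinuousAt (fun t : ℝ => l * t) 0 := by fun_prop
      simpa using this.tendsto.mono_left nhdsWithin_le_nhds
    · filter_upwards [self_mem_nhdsWithin] with t ht
      exact mul_pos hl ht
  have h := exp_neg_mul_besselI_sum_sub_isBigO.comp_tendsto hlt
  have h6 := ((isBigO_refl (fun t : ℝ => t ^ 6) (𝓝[>] 0)).mul h).const_mul_left (v ^ 6)
  have h9 : (fun t : ℝ => t ^ 6 * (l * t) ^ 3) =o[𝓝[>] 0] fun t : ℝ => t ^ 8 :=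
    (((isLittleO_pow_pow (show 8 < 9 by norm_num)).mono nhdsWithin_le_nhds).const_mul_left
      (l ^ 3)).congr_left fun t => by ring
  refine (h6.trans_isLittleO h9).congr_left fun t => ?_
  simp only [Function.comp_apply]
  ring
end

section
/- Let v > 0 and Δ > 0, and define f : (0, ∞) → ℝ by f(λ) = (v²/λ)(Δ − (1 − e^{−2λΔ})/(2λ)). Then f is strictly decreasing on (0, ∞), f(λ) → v²Δ² as λ → 0⁺, and f(λ) → 0 as λ → ∞. Consequently f is a bijection from (0, ∞) onto (0, v²Δ²). -/
open Real Filter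

/-- The lower Padé bound for `e^{-x}`, with the denominator cleared. -/
theorem two_sub_lt_add_two_mul_exp_neg {x : ℝ} (hx : 0 < x) :
    2 - x < (x + 2) * Real.exp (-x) := by
  have hd (t : ℝ) : HasDerivAt (fun t : ℝ => (t + 2) * Real.exp (-t) + t)
      (1 - (t + 1) * Real.exp (-t)) t := by
    have h := (((hasDerivAt_id' t).add_const 2).mul (hasDerivAt_neg t).exp).add (hasDerivAt_id' t)
    refine h.congr_deriv ?_
    ring
  have hmono : StrictMonoOn (fun t : ℝ => (t + 2) * Real.exp (-t) + t) (Set.Ici 0) := by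
    refine strictMonoOn_of_deriv_pos (convex_Ici 0)
      (fun t _ => (hd t).continuousAt.continuousWithinAt) fun t ht => ?_
    rw [interior_Ici] at ht
    have h := mul_lt_mul_of_pos_right (Real.add_one_lt_exp (ne_of_gt ht)) (Real.exp_pos (-t))
    rw [← Real.exp_add, add_neg_cancel, Real.exp_zero] at h
    rw [(hd t).deriv]
    linarith
  have h := hmono Set.self_mem_Ici hx.le hx
  norm_num at h
  linarith

theorem exp_neg_lt_quadratic {x : ℝ} (hx : 0 < x) :
    Real.exp (-x) < 1 - x + x ^ 2 / 2 := by
  have h1 := Real.quadratic_le_exp_of_nonneg hx.le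
  have hq : 0 < 1 - x + x ^ 2 / 2 := by nlinarith [sq_nonneg (x - 1)]
  rw [Real.exp_neg, inv_lt_iff_one_lt_mul₀ (Real.exp_pos x)]
  have h2 := mul_le_mul_of_nonneg_left h1 hq.le
  have h3 : 0 < x ^ 4 := by positivity
  nlinarith

theorem strictAntiOn_sub_one_add_exp_neg_div_sq :
    StrictAntiOn (fun x : ℝ => (x - 1 + Real.exp (-x)) / x ^ 2) (Set.Ioi 0) := by
  have hd {x : ℝ} (hx : 0 < x) : HasDerivAt (fun x : ℝ => (x - 1 + Real.exp (-x)) / x ^ 2)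
      ((2 - x - (x + 2) * Real.exp (-x)) / x ^ 3) x := by
    have h := (((hasDerivAt_id' x).sub_const 1).add (hasDerivAt_neg x).exp).div
      (hasDerivAt_pow 2 x) (by positivity)
    refine h.congr_deriv ?_
    simp only [Pi.add_apply]
    field_simp
    push_cast
    ring
  refine strictAntiOn_of_deriv_neg (convex_Ioi 0)
    (fun x hx => (hd hx).continuousAt.continuousWithinAt) fun x hx => ?_
  rw [interior_Ioi] at hx
  have hx : 0 < x := hx
  rw [(hd hx).deriv]
  exact div_neg_of_neg_of_pos (by linarith [two_sub_lt_add_two_mul_exp_neg hx]) (by positivity)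

/-- with `f(λ) = (v²/λ)(Δ − (1 − e^{−2λΔ})/(2λ))`, `f` is strictly
decreasing on `(0, ∞)`, `f(λ) → v²Δ²` as `λ → 0⁺`, `f(λ) → 0` as `λ → ∞`, and
consequently `f` is a bijection from `(0, ∞)` onto `(0, v²Δ²)`. -/
theorem stmt_14 (v Δ : ℝ) (hv : 0 < v) (hΔ : 0 < Δ)
    (f : ℝ → ℝ)
    (hf : ∀ l : ℝ, f l = (v ^ 2 / l) * (Δ - (1 - Real.exp (-(2 * l * Δ))) / (2 * l))) :
    StrictAntiOn f (Set.Ioi 0) ∧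
      Tendsto f (nhdsWithin 0 (Set.Ioi 0)) (nhds (v ^ 2 * Δ ^ 2)) ∧
      Tendsto f atTop (nhds 0) ∧
      Set.BijOn f (Set.Ioi 0) (Set.Ioo 0 (v ^ 2 * Δ ^ 2)) := by
  have hfg {l : ℝ} (hl : 0 < l) : f l = 2 * (v ^ 2 * Δ ^ 2) *
      ((2 * l * Δ - 1 + Real.exp (-(2 * l * Δ))) / (2 * l * Δ) ^ 2) := by
    rw [hf]
    field_simp
    ring
  have hc : 0 < v ^ 2 * Δ ^ 2 := by positivity
  have hlower {l : ℝ} (hl : 0 < l) : v ^ 2 * Δ ^ 2 / (1 + l * Δ) < f l := by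
    have hx : 0 < 2 * l * Δ := by positivity
    have h : 1 / (2 * l * Δ + 2) <
        (2 * l * Δ - 1 + Real.exp (-(2 * l * Δ))) / (2 * l * Δ) ^ 2 := by
      rw [div_lt_div_iff₀ (by positivity) (by positivity)]
      nlinarith [two_sub_lt_add_two_mul_exp_neg hx]
    rw [hfg hl]
    calc v ^ 2 * Δ ^ 2 / (1 + l * Δ) = 2 * (v ^ 2 * Δ ^ 2) * (1 / (2 * l * Δ + 2)) := by
          field_simp
          ring
      _ < _ := mul_lt_mul_of_pos_left h (by positivity)
  have hpos {l : ℝ} (hl : 0 < l) : 0 < f l := lt_trans (by positivity) (hlower hl)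
  have hupper {l : ℝ} (hl : 0 < l) : f l < v ^ 2 * Δ ^ 2 := by
    have hx : 0 < 2 * l * Δ := by positivity
    have h : (2 * l * Δ - 1 + Real.exp (-(2 * l * Δ))) / (2 * l * Δ) ^ 2 < 1 / 2 := by
      rw [div_lt_iff₀ (by positivity)]
      linarith [exp_neg_lt_quadratic hx]
    rw [hfg hl]
    nlinarith
  have hdecay {l : ℝ} (hl : 0 < l) : f l ≤ v ^ 2 * Δ / l := by
    have he : Real.exp (-(2 * l * Δ)) ≤ 1 := Real.exp_le_one_iff.2 (by
      have : 0 < 2 * l * Δ := by positivity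
      linarith)
    have h : 0 ≤ (1 - Real.exp (-(2 * l * Δ))) / (2 * l) :=
      div_nonneg (by linarith) (by positivity)
    rw [hf, mul_div_right_comm]
    exact mul_le_mul_of_nonneg_left (by linarith) (by positivity)
  have hanti : StrictAntiOn f (Set.Ioi 0) := by
    intro a ha b hb hab
    have ha : 0 < a := ha
    have hb : 0 < b := hb
    rw [hfg ha, hfg hb]
    refine mul_lt_mul_of_pos_left (strictAntiOn_sub_one_add_exp_neg_div_sq
      (Set.mem_Ioi.2 (by positivity)) (Set.mem_Ioi.2 (by positivity)) ?_) (by positivity)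
    gcongr
  have hzero : Tendsto f (nhdsWithin 0 (Set.Ioi 0)) (nhds (v ^ 2 * Δ ^ 2)) := by
    have h : Tendsto (fun l : ℝ => v ^ 2 * Δ ^ 2 / (1 + l * Δ)) (nhdsWithin 0 (Set.Ioi 0))
        (nhds (v ^ 2 * Δ ^ 2)) := by
      have : ContinuousAt (fun l : ℝ => v ^ 2 * Δ ^ 2 / (1 + l * Δ)) 0 :=
        ContinuousAt.div (by fun_prop) (by fun_prop) (by simp)
      simpa using this.tendsto.mono_left nhdsWithin_le_nhds
    refine tendsto_of_tendsto_of_tendsto_of_le_of_le' h tendsto_const_nhds ?_ ?_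
    · filter_upwards [self_mem_nhdsWithin] with l hl using (hlower hl).le
    · filter_upwards [self_mem_nhdsWithin] with l hl using (hupper hl).le
  have htop : Tendsto f atTop (nhds 0) := by
    refine tendsto_of_tendsto_of_tendsto_of_le_of_le' tendsto_const_nhds
      (tendsto_const_nhds.div_atTop tendsto_id : Tendsto (fun l : ℝ => v ^ 2 * Δ / l) _ _) ?_ ?_
    · filter_upwards [eventually_gt_atTop 0] with l hl using (hpos hl).le
    · filter_upwards [eventually_gt_atTop 0] with l hl using hdecay hl
  have hcont : ContinuousOn f (Set.Ioi 0) := by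
    intro l hl
    have hl : l ≠ 0 := ne_of_gt hl
    rw [funext hf]
    refine ContinuousAt.continuousWithinAt ?_
    fun_prop (disch := simpa using hl)
  refine ⟨hanti, hzero, htop, fun l hl => ⟨hpos hl, hupper hl⟩, hanti.injOn, ?_⟩
  exact isPreconnected_Ioi.intermediate_value_Ioo
    (le_principal_iff.2 (Ioi_mem_atTop 0)) (le_principal_iff.2 self_mem_nhdsWithin)
    hcont htop hzero
end

section
/- Let λ > 0. Define, for Δ > 0, g(Δ) = Δ λ² ( −1 − 16 e^{2Δλ}(1 + Δλ) + e^{4Δλ}(17 + 4Δλ(2Δλ − 5)) ) / ( 4 (1 + Δλ + e^{2Δλ}(Δλ − 1))² ). Then g(Δ) → (6/5) λ as Δ → 0⁺. -/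
open Real Filter

/-- The remainder of the degree-five Taylor polynomial of `exp (c * x)` at `0` is `o(x ^ 5)`. -/
lemma tendsto_exp_taylor_five_remainder (c : ℝ) :
    Tendsto (fun x : ℝ => (Real.exp (c * x) - (1 + c * x + (c * x) ^ 2 / 2 + (c * x) ^ 3 / 6 +
      (c * x) ^ 4 / 24 + (c * x) ^ 5 / 120)) / x ^ 5) (nhds 0) (nhds 0) := by
  have hc : Tendsto (fun x : ℝ => c * x) (nhds 0) (nhds 0) :=
    Continuous.tendsto' (by fun_prop) _ _ (by simp)
  have h := (Real.exp_sub_sum_range_succ_isLittleO_pow 5).comp_tendsto hc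
  have hO : ((fun x : ℝ => x ^ 5) ∘ fun x => c * x) =O[nhds 0] fun x : ℝ => x ^ 5 := by
    simpa [Function.comp_def, mul_pow] using
      Asymptotics.isBigO_const_mul_self (c ^ 5) (fun x : ℝ => x ^ 5) (nhds 0)
  refine (h.trans_isBigO hO).tendsto_div_nhds_zero.congr fun x => ?_
  simp [Finset.sum_range_succ, Nat.factorial]

lemma tendsto_telegraph_denominator :
    Tendsto (fun x : ℝ => (1 + x + Real.exp (2 * x) * (x - 1)) / x ^ 3)
      (nhdsWithin 0 {0}ᶜ) (nhds (2 / 3)) := by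
  have h := (tendsto_exp_taylor_five_remainder 2).mono_left
    (nhdsWithin_le_nhds (s := ({0}ᶜ : Set ℝ)))
  have hp : Tendsto (fun x : ℝ => 2 / 3 + 2 / 3 * x + 2 / 5 * x ^ 2 + 4 / 15 * x ^ 3)
      (nhdsWithin 0 {0}ᶜ) (nhds (2 / 3)) :=
    (Continuous.tendsto' (by fun_prop) _ _ (by simp)).mono_left nhdsWithin_le_nhds
  have hq : Tendsto (fun x : ℝ => x ^ 2 * (x - 1)) (nhdsWithin 0 {0}ᶜ) (nhds 0) :=
    (Continuous.tendsto' (by fun_prop) _ _ (by simp)).mono_left nhdsWithin_le_nhds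
  have key := hp.add (h.mul hq)
  simp only [mul_zero, add_zero] at key
  refine key.congr' ?_
  filter_upwards [self_mem_nhdsWithin] with x hx
  have hx : x ≠ 0 := hx
  field_simp
  ring

lemma tendsto_telegraph_numerator :
    Tendsto (fun x : ℝ => (-1 - 16 * Real.exp (2 * x) * (1 + x) +
        Real.exp (4 * x) * (17 + 4 * x * (2 * x - 5))) / x ^ 5)
      (nhdsWithin 0 {0}ᶜ) (nhds (32 / 15)) := by
  have h2 := (tendsto_exp_taylor_five_remainder 2).mono_left
    (nhdsWithin_le_nhds (s := ({0}ᶜ : Set ℝ)))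
  have h4 := (tendsto_exp_taylor_five_remainder 4).mono_left
    (nhdsWithin_le_nhds (s := ({0}ᶜ : Set ℝ)))
  have hp : Tendsto (fun x : ℝ => 32 / 15 - 448 / 5 * x + 1024 / 15 * x ^ 2)
      (nhdsWithin 0 {0}ᶜ) (nhds (32 / 15)) :=
    (Continuous.tendsto' (by fun_prop) _ _ (by simp)).mono_left nhdsWithin_le_nhds
  have hq : Tendsto (fun x : ℝ => -16 * (1 + x)) (nhdsWithin 0 {0}ᶜ) (nhds (-16)) :=
    (Continuous.tendsto' (by fun_prop) _ _ (by simp)).mono_left nhdsWithin_le_nhds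
  have hr : Tendsto (fun x : ℝ => 17 + 4 * x * (2 * x - 5)) (nhdsWithin 0 {0}ᶜ) (nhds 17) :=
    (Continuous.tendsto' (by fun_prop) _ _ (by simp)).mono_left nhdsWithin_le_nhds
  have key := (hp.add (h2.mul hq)).add (h4.mul hr)
  simp only [zero_mul, add_zero] at key
  refine key.congr' ?_
  filter_upwards [self_mem_nhdsWithin] with x hx
  have hx : x ≠ 0 := hx
  field_simp
  ring

/-- with
`g(Δ) = Δλ²(−1 − 16e^{2Δλ}(1 + Δλ) + e^{4Δλ}(17 + 4Δλ(2Δλ − 5)))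
        / (4(1 + Δλ + e^{2Δλ}(Δλ − 1))²)`,
`g(Δ) → (6/5)λ` as `Δ → 0⁺`. -/
theorem stmt_16 (l : ℝ) (hl : 0 < l) :
    Tendsto
      (fun Δ : ℝ =>
        Δ * l ^ 2 * (-1 - 16 * Real.exp (2 * Δ * l) * (1 + Δ * l) +
            Real.exp (4 * Δ * l) * (17 + 4 * (Δ * l) * (2 * (Δ * l) - 5))) /
          (4 * (1 + Δ * l + Real.exp (2 * Δ * l) * (Δ * l - 1)) ^ 2))
      (nhdsWithin 0 (Set.Ioi 0)) (nhds (6 / 5 * l)) := by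
  have hs : Tendsto (fun Δ : ℝ => Δ * l) (nhdsWithin 0 (Set.Ioi 0)) (nhdsWithin 0 {0}ᶜ) := by
    refine tendsto_nhdsWithin_iff.2
      ⟨(Continuous.tendsto' (by fun_prop) _ _ (by simp)).mono_left nhdsWithin_le_nhds, ?_⟩
    filter_upwards [self_mem_nhdsWithin] with x hx
    exact (mul_pos hx hl).ne'
  have key := ((tendsto_telegraph_numerator.div
    ((tendsto_telegraph_denominator.pow 2).const_mul 4) (by norm_num)).const_mul l).comp hs
  have hlim : l * (32 / 15 / (4 * (2 / 3) ^ 2)) = 6 / 5 * l := by ring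
  rw [hlim] at key
  refine key.congr' ?_
  filter_upwards [self_mem_nhdsWithin] with x hx
  have hx : x ≠ 0 := ne_of_gt hx
  have e2 : 2 * x * l = 2 * (x * l) := by ring
  have e4 : 4 * x * l = 4 * (x * l) := by ring
  simp only [Function.comp_apply, Pi.div_apply, e2, e4]
  generalize -1 - 16 * Real.exp (2 * (x * l)) * (1 + x * l) +
    Real.exp (4 * (x * l)) * (17 + 4 * (x * l) * (2 * (x * l) - 5)) = N
  generalize 1 + x * l + Real.exp (2 * (x * l)) * (x * l - 1) = D
  rcases eq_or_ne D 0 with rfl | hD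
  · simp
  · field_simp
end
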